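/- Let θ = Σ_{d=1}^∞ (log d)/d². There exists a constant C > 0 such that for every positive integer N ≥ 2, |−2N Σ_{d ≤ √N} (log d)/d² − (−2Nθ + √N log N + 2√N)| ≤ C log N, where the sum is over positive integers d with d ≤ √N. -/

import Mathlib

open Finset Real

lemma hasDerivAt_log_add_one_div {x : ℝ} (hx : 0 < x) :
    HasDerivAt (fun y : ℝ => (Real.log y + 1) / y) (-(Real.log x / x ^ 2)) x := by
  have h := ((Real.hasDerivAt_log hx.ne').add_const 1).div (hasDerivAt_id x) hx.ne'
  refine h.congr_deriv ?_
  simp only [id]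
  field_simp
  ring

lemma antitoneOn_log_add_one_div :
    AntitoneOn (fun y : ℝ => (Real.log y + 1) / y) (Set.Ici 1) := by
  have hd : ∀ x : ℝ, 1 ≤ x →
      HasDerivAt (fun y : ℝ => (Real.log y + 1) / y) (-(Real.log x / x ^ 2)) x :=
    fun x hx => hasDerivAt_log_add_one_div (by linarith)
  refine antitoneOn_of_deriv_nonpos (convex_Ici 1)
    (fun x hx => (hd x hx).continuousAt.continuousWithinAt) ?_ ?_
  · intro x hx
    rw [interior_Ici] at hx
    exact (hd x hx.le).differentiableAt.differentiableWithinAt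
  · intro x hx
    rw [interior_Ici] at hx
    rw [(hd x hx.le).deriv]
    have := Real.log_nonneg hx.le
    exact neg_nonpos.mpr (by positivity)

lemma tendsto_log_add_one_div_atTop :
    Filter.Tendsto (fun y : ℝ => (Real.log y + 1) / y) Filter.atTop (nhds 0) := by
  have h1 : Filter.Tendsto (fun y : ℝ => Real.log y / y) Filter.atTop (nhds 0) :=
    Real.isLittleO_log_id_atTop.tendsto_div_nhds_zero
  simpa [add_div] using h1.add tendsto_inv_atTop_zero

lemma log_div_sq_le_log_div_sq {x y : ℝ} (hx : 3 ≤ x) (hxy : x ≤ y) :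
    Real.log y / y ^ 2 ≤ Real.log x / x ^ 2 := by
  have he : Real.exp 2⁻¹ ≤ 3 :=
    (Real.exp_le_exp.mpr (by norm_num)).trans Real.exp_one_lt_three.le
  have h := Real.log_div_self_rpow_antitoneOn (a := 2) (by norm_num)
    (show x ∈ Set.Ici (Real.exp 2⁻¹) from he.trans hx)
    (show y ∈ Set.Ici (Real.exp 2⁻¹) from he.trans (hx.trans hxy)) hxy
  simpa using h

lemma log_div_sq_bounds_sub {x : ℝ} (hx : 3 ≤ x) :
    Real.log (x + 1) / (x + 1) ^ 2 ≤
        (Real.log x + 1) / x - (Real.log (x + 1) + 1) / (x + 1) ∧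
      (Real.log x + 1) / x - (Real.log (x + 1) + 1) / (x + 1) ≤ Real.log x / x ^ 2 := by
  obtain ⟨c, hc, h⟩ := exists_hasDerivAt_eq_slope (fun y : ℝ => (Real.log y + 1) / y)
    (fun y => -(Real.log y / y ^ 2)) (lt_add_one x)
    (fun y hy => (hasDerivAt_log_add_one_div
      (by linarith [hy.1])).continuousAt.continuousWithinAt)
    (fun y hy => hasDerivAt_log_add_one_div (by linarith [hy.1]))
  have h1 := log_div_sq_le_log_div_sq hx hc.1.le
  have h2 := log_div_sq_le_log_div_sq (hx.trans hc.1.le) hc.2.le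
  simp only [add_sub_cancel_left, div_one] at h
  constructor <;> linarith

lemma hasSum_log_add_one_div_sub {M : ℕ} (hM : 1 ≤ M) :
    HasSum (fun i : ℕ => (Real.log ((i + M : ℕ) : ℝ) + 1) / ((i + M : ℕ) : ℝ) -
      (Real.log (((i + M : ℕ) : ℝ) + 1) + 1) / (((i + M : ℕ) : ℝ) + 1))
      ((Real.log M + 1) / M) := by
  rw [hasSum_iff_tendsto_nat_of_nonneg]
  · have hlim : Filter.Tendsto
        (fun n : ℕ => (Real.log ((n + M : ℕ) : ℝ) + 1) / ((n + M : ℕ) : ℝ))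
        Filter.atTop (nhds 0) :=
      tendsto_log_add_one_div_atTop.comp
        (tendsto_natCast_atTop_atTop.comp (Filter.tendsto_add_atTop_nat M))
    have h := hlim.const_sub ((Real.log M + 1) / M)
    rw [sub_zero] at h
    refine h.congr fun n => ?_
    have := Finset.sum_range_sub'
      (fun i : ℕ => (Real.log ((i + M : ℕ) : ℝ) + 1) / ((i + M : ℕ) : ℝ)) n
    simp only [zero_add] at this
    rw [← this]
    refine Finset.sum_congr rfl fun i _ => ?_
    rw [show i + 1 + M = i + M + 1 by ring, Nat.cast_add_one (i + M)]
  · intro i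
    have h1 : (1 : ℝ) ≤ ((i + M : ℕ) : ℝ) := by exact_mod_cast (by omega : 1 ≤ i + M)
    exact sub_nonneg.mpr (antitoneOn_log_add_one_div h1
      (show (1 : ℝ) ≤ ((i + M : ℕ) : ℝ) + 1 by linarith) (by linarith))

lemma summable_log_div_sq : Summable (fun d : ℕ => Real.log d / (d : ℝ) ^ 2) := by
  rw [← summable_nat_add_iff 4]
  refine Summable.of_nonneg_of_le (fun i => ?_) (fun i => ?_)
    (hasSum_log_add_one_div_sub (M := 3) (by norm_num)).summable
  · have := Real.log_natCast_nonneg (i + 4)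
    positivity
  · have h := (log_div_sq_bounds_sub (x := ((i + 3 : ℕ) : ℝ))
      (by exact_mod_cast (by omega : 3 ≤ i + 3))).1
    rwa [← Nat.cast_add_one (i + 3)] at h ⊢

lemma log_div_sq_tail_bounds {M : ℕ} (hM : 3 ≤ M) :
    (Real.log ((M : ℝ) + 1) + 1) / ((M : ℝ) + 1) ≤
        ∑' i : ℕ, Real.log ((i + (M + 1) : ℕ) : ℝ) / ((i + (M + 1) : ℕ) : ℝ) ^ 2 ∧
      ∑' i : ℕ, Real.log ((i + (M + 1) : ℕ) : ℝ) / ((i + (M + 1) : ℕ) : ℝ) ^ 2 ≤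
        (Real.log M + 1) / M := by
  have hs := ((summable_nat_add_iff (M + 1)).mpr summable_log_div_sq).hasSum
  constructor
  · have h := hasSum_log_add_one_div_sub (M := M + 1) (by omega)
    rw [Nat.cast_add_one M] at h
    exact hasSum_le (fun i => (log_div_sq_bounds_sub
      (by exact_mod_cast (by omega : 3 ≤ i + (M + 1)))).2) h hs
  · refine hasSum_le (fun i => ?_) hs (hasSum_log_add_one_div_sub (M := M) (by omega))
    have h := (log_div_sq_bounds_sub (x := ((i + M : ℕ) : ℝ))
      (by exact_mod_cast (by omega : 3 ≤ i + M))).1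
    rwa [← Nat.cast_add_one (i + M)] at h ⊢

lemma abs_partial_log_div_sq_sub_le {N : ℕ} (hN : 9 ≤ N) :
    |(-2 * (N : ℝ) * ∑ d ∈ Finset.Icc 1 (Nat.sqrt N), Real.log d / (d : ℝ) ^ 2)
        - (-2 * (N : ℝ) * (∑' d : ℕ, Real.log d / (d : ℝ) ^ 2)
            + Real.sqrt N * Real.log N + 2 * Real.sqrt N)|
      ≤ 4 * Real.log N := by
  have hM : 3 ≤ Nat.sqrt N := Nat.le_sqrt.mpr (by omega)
  have hsum : ∑ d ∈ Finset.Icc 1 (Nat.sqrt N), Real.log d / (d : ℝ) ^ 2 =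
      ∑ d ∈ Finset.range (Nat.sqrt N + 1), Real.log d / (d : ℝ) ^ 2 := by
    rw [Finset.range_eq_Ico, Finset.sum_eq_sum_Ico_succ_bot (by omega)]
    simp [← Finset.Ico_add_one_right_eq_Icc]
  have htail := summable_log_div_sq.sum_add_tsum_nat_add (Nat.sqrt N + 1)
  rw [← hsum] at htail
  obtain ⟨hlo, hhi⟩ := log_div_sq_tail_bounds hM
  rw [← htail]
  have hMx : (Nat.sqrt N : ℝ) ≤ √(N : ℝ) := Real.nat_sqrt_le_real_sqrt
  have hxM : √(N : ℝ) ≤ (Nat.sqrt N : ℝ) + 1 := Real.real_sqrt_le_nat_sqrt_succ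
  have hM3 : (3 : ℝ) ≤ (Nat.sqrt N : ℝ) := by exact_mod_cast hM
  have hxx : (N : ℝ) = √(N : ℝ) ^ 2 := (Real.sq_sqrt (Nat.cast_nonneg N)).symm
  have hlog : Real.log N = 2 * Real.log √(N : ℝ) := by
    rw [Real.log_sqrt (Nat.cast_nonneg N)]; ring
  generalize ∑' i : ℕ, Real.log ((i + (Nat.sqrt N + 1) : ℕ) : ℝ) /
    ((i + (Nat.sqrt N + 1) : ℕ) : ℝ) ^ 2 = T at *
  generalize ∑ d ∈ Finset.Icc 1 (Nat.sqrt N), Real.log d / (d : ℝ) ^ 2 = S at *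
  generalize (Nat.sqrt N : ℝ) = m at *
  rw [hlog]
  generalize √(N : ℝ) = x at *
  rw [hxx]
  have hx0 : 0 < x := by linarith
  have hm0 : 0 < m := by linarith
  have hF1 : (Real.log x + 1) / x ≤ (Real.log m + 1) / m :=
    antitoneOn_log_add_one_div (show (1 : ℝ) ≤ m by linarith)
      (show (1 : ℝ) ≤ x by linarith) hMx
  have hF2 : (Real.log (m + 1) + 1) / (m + 1) ≤ (Real.log x + 1) / x :=
    antitoneOn_log_add_one_div (show (1 : ℝ) ≤ x by linarith)
      (show (1 : ℝ) ≤ m + 1 by linarith) hxM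
  have hstep := (log_div_sq_bounds_sub hM3).2
  have hdiff : |T - (Real.log x + 1) / x| ≤ Real.log m / m ^ 2 :=
    abs_le.mpr ⟨by linarith, by linarith⟩
  have hexpr : -2 * x ^ 2 * S - (-2 * x ^ 2 * (S + T) + x * (2 * Real.log x) + 2 * x) =
      2 * x ^ 2 * (T - (Real.log x + 1) / x) := by
    field_simp
    ring
  rw [hexpr, abs_mul, abs_of_pos (by positivity : 0 < 2 * x ^ 2)]
  have hlm : Real.log m ≤ Real.log x := Real.log_le_log hm0 hMx
  have hlm0 : 0 ≤ Real.log m := Real.log_nonneg (by linarith)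
  have hx2 : x ^ 2 ≤ 4 * m ^ 2 := by nlinarith
  calc 2 * x ^ 2 * |T - (Real.log x + 1) / x|
      ≤ 2 * x ^ 2 * (Real.log m / m ^ 2) := by gcongr
    _ ≤ 2 * (4 * m ^ 2) * (Real.log m / m ^ 2) := by gcongr
    _ = 8 * Real.log m := by field_simp; ring
    _ ≤ 4 * (2 * Real.log x) := by linarith

/-- `−2N Σ_{d ≤ √N} (log d)/d² = −2Nθ + √N log N + 2√N + O(log N)`, where
`θ = Σ_{d=1}^∞ (log d)/d²`. -/
theorem partial_log_div_sq_asymptotic :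
    ∃ C : ℝ, 0 < C ∧ ∀ N : ℕ, 2 ≤ N →
      |(-2 * (N : ℝ) * ∑ d ∈ Finset.Icc 1 (Nat.sqrt N), Real.log d / (d : ℝ) ^ 2)
          - (-2 * (N : ℝ) * (∑' d : ℕ, Real.log d / (d : ℝ) ^ 2)
              + Real.sqrt N * Real.log N + 2 * Real.sqrt N)|
        ≤ C * Real.log N := by
  have hbig := fun (N : ℕ) (hN : 9 ≤ N) => abs_partial_log_div_sq_sub_le hN
  set E : ℕ → ℝ := fun N =>
    (-2 * (N : ℝ) * ∑ d ∈ Finset.Icc 1 (Nat.sqrt N), Real.log d / (d : ℝ) ^ 2)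
      - (-2 * (N : ℝ) * (∑' d : ℕ, Real.log d / (d : ℝ) ^ 2)
          + Real.sqrt N * Real.log N + 2 * Real.sqrt N)
  have hnonneg : ∀ n ∈ Finset.range 9, 0 ≤ |E n| / Real.log n := fun n _ =>
    div_nonneg (abs_nonneg _) (Real.log_natCast_nonneg n)
  have hC := Finset.sum_nonneg hnonneg
  refine ⟨4 + ∑ n ∈ Finset.range 9, |E n| / Real.log n, by linarith, fun N hN => ?_⟩
  have hlog : 0 < Real.log N := Real.log_pos (by exact_mod_cast hN)
  change |E N| ≤ _
  rcases le_or_gt 9 N with h | h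
  · exact (hbig N h).trans (mul_le_mul_of_nonneg_right (by linarith) hlog.le)
  · rw [← div_le_iff₀ hlog]
    have := Finset.single_le_sum hnonneg (Finset.mem_range.mpr h)
    linarith
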